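/- Let (d⃗,b⃗) be a bike-optimal allocation, let (d⃗^z,b⃗^z) minimize c over S_z(d⃗,b⃗), and let (d⃗^{z+1},b⃗^{z+1}) be a minimizer of c over N(d⃗^z,b⃗^z). If there exists an allocation (d⃗*,b⃗*) ∈ S_{z+1}(d⃗,b⃗) with c(d⃗*,b⃗*) < c(d⃗^{z+1},b⃗^{z+1}), then there exist stations j and k with d_j*+b_j* > d_j^z+b_j^z ≥ d_j+b_j and d_k*+b_k* < d_k^z+b_k^z ≤ d_k+b_k. -/

import Mathlib

/-- Multimodularity of `f : ℕ² → ℝ`. -/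
def Multimodular (f : ℕ → ℕ → ℝ) : Prop :=
  (∀ d b : ℕ, f (d+1) (b+1) - f (d+1) b ≥ f d (b+1) - f d b) ∧
  (∀ d b : ℕ, f d (b+2) - f d (b+1) ≥ f (d+1) (b+1) - f (d+1) b) ∧
  (∀ d b : ℕ, f (d+2) b - f (d+1) b ≥ f (d+1) (b+1) - f d (b+1))

/-- An allocation over `n` stations: open docks and bikes at each station. -/
abbrev Alloc (n : ℕ) := (Fin n → ℕ) × (Fin n → ℕ)

/-- Objective: total expected user dissatisfaction `c(d⃗,b⃗) = Σ_i c_i(d_i,b_i)`. -/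
def obj {n : ℕ} (c : Fin n → ℕ → ℕ → ℝ) (a : Alloc n) : ℝ :=
  ∑ i, c i (a.1 i) (a.2 i)

/-- Move one unit of the vector `v` from coordinate `i` to coordinate `j`. -/
def moveOne {n : ℕ} (v : Fin n → ℕ) (i j : Fin n) : Fin n → ℕ :=
  fun k => v k - (if k = i then 1 else 0) + (if k = j then 1 else 0)

/-- The set of allocations obtained from `a` by a single dock-move from station `i` to
station `j`: one of `o_{ij}`, `e_{ij}`, `E_{ijh}`, `O_{ijh}` (defined whenever the
result is componentwise nonnegative). -/
def MoveFromTo {n : ℕ} (a : Alloc n) (i j : Fin n) : Set (Alloc n) :=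
  {a' | (1 ≤ a.1 i ∧ a' = (moveOne a.1 i j, a.2)) ∨
        (1 ≤ a.2 i ∧ a' = (a.1, moveOne a.2 i j)) ∨
        (∃ h, 1 ≤ a.1 i ∧ 1 ≤ a.2 h ∧ a' = (moveOne a.1 i h, moveOne a.2 h j)) ∨
        (∃ h, 1 ≤ a.1 h ∧ 1 ≤ a.2 i ∧ a' = (moveOne a.1 h j, moveOne a.2 i h))}

/-- The neighborhood `N(a)`: all allocations one dock-move away from `a`. -/
def Neighborhood {n : ℕ} (a : Alloc n) : Set (Alloc n) :=
  ⋃ (i : Fin n) (j : Fin n), MoveFromTo a i j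

/-- Dock-move distance `Σ_i |(d_i+b_i) − (d_i′+b_i′)|`. -/
def dockDist {n : ℕ} (a a' : Alloc n) : ℕ :=
  ∑ i, ((a.1 i + a.2 i : ℤ) - (a'.1 i + a'.2 i : ℤ)).natAbs

/-- `a` is bike-optimal: it minimizes the objective among allocations with the same
number of docks at each station and the same total number of bikes. -/
def BikeOptimal {n : ℕ} (c : Fin n → ℕ → ℕ → ℝ) (a : Alloc n) : Prop :=
  ∀ a' : Alloc n, (∀ i, a'.1 i + a'.2 i = a.1 i + a.2 i) →
    (∑ i, a'.2 i = ∑ i, a.2 i) → obj c a ≤ obj c a'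

/-- The `z`-ball `S_z(a)` around allocation `a`. -/
def ball {n : ℕ} (a : Alloc n) : ℕ → Set (Alloc n)
  | 0 => {a}
  | z + 1 => ball a z ∪ ⋃ a' ∈ ball a z, Neighborhood a'

/-- Total number of docks at a station. -/
def stn {n : ℕ} (a : Alloc n) (i : Fin n) : ℕ := a.1 i + a.2 i

/-- Two allocations with the same totals of open docks and of bikes. -/
def SameTot {n : ℕ} (a a' : Alloc n) : Prop :=
  ∑ i, a.1 i = ∑ i, a'.1 i ∧ ∑ i, a.2 i = ∑ i, a'.2 i

/-- One-sided dock distance from `a` to `x`. -/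
def updist {n : ℕ} (a x : Alloc n) : ℕ := ∑ i, (stn x i - stn a i)

theorem mm_flip {f : ℕ → ℕ → ℝ} (hf : Multimodular f) : Multimodular (fun x y => f y x) := by
  obtain ⟨h1, h2, h3⟩ := hf
  refine ⟨fun d b => ?_, fun d b => ?_, fun d b => ?_⟩
  · have := h1 b d
    simp only
    linarith
  · have := h3 b d
    simp only
    linarith
  · have := h2 b d
    simp only
    linarith

theorem mm_d {f : ℕ → ℕ → ℝ} (hf : Multimodular f) {dx bx dy by' : ℕ}
    (hd : dy < dx) (hs : dy + by' < dx + bx) :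
    f (dx - 1) bx + f (dy + 1) by' ≤ f dx bx + f dy by' := by
  obtain ⟨h1, h2, h3⟩ := hf
  have mb : ∀ k d b, f (d+1) b - f d b ≤ f (d+1) (b+k) - f d (b+k) := by
    intro k
    induction k with
    | zero => intro d b; simp
    | succ k ih =>
      intro d b
      have := ih d b
      have := h1 d (b+k)
      rw [← add_assoc]
      linarith
  have mdb : ∀ k d b, f (d+1) (b+k) - f d (b+k) ≤ f (d+k+1) b - f (d+k) b := by
    intro k
    induction k with
    | zero => intro d b; simp
    | succ k ih =>
      intro d b
      have e1 := ih d (b+1)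
      have e2 := h3 (d+k) b
      rw [show b + (k+1) = b+1+k by ring, show d+(k+1)=d+k+1 by ring]
      linarith
  have md : ∀ k d b, f (d+1) b - f d b ≤ f (d+k+1) b - f (d+k) b := by
    intro k d b
    linarith [mb k d b, mdb k d b]
  obtain ⟨e, rfl⟩ : ∃ e, dx = dy + e + 1 := ⟨dx - dy - 1, by omega⟩
  rw [Nat.add_sub_cancel]
  rcases le_total by' bx with h | h
  · obtain ⟨k, rfl⟩ := Nat.exists_eq_add_of_le h
    linarith [mb k dy by', md e dy (by'+k)]
  · obtain ⟨k, rfl⟩ := Nat.exists_eq_add_of_le h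
    obtain ⟨l, rfl⟩ : ∃ l, e = k + l := Nat.exists_eq_add_of_le (by omega)
    have e1 := mdb k dy bx
    have e2 := md l (dy+k) bx
    rw [← add_assoc]
    linarith

theorem mm_b {f : ℕ → ℕ → ℝ} (hf : Multimodular f) {dx bx dy by' : ℕ}
    (hd : by' < bx) (hs : dy + by' < dx + bx) :
    f dx (bx - 1) + f dy (by' + 1) ≤ f dx bx + f dy by' :=
  mm_d (mm_flip hf) (dx := bx) (bx := dx) (dy := by') (by' := dy) hd (by omega)

theorem mm_swap {f : ℕ → ℕ → ℝ} (hf : Multimodular f) {dx bx dy by' : ℕ}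
    (hd : dy < dx) (hb : bx < by') :
    f (dx - 1) (bx + 1) + f (dy + 1) (by' - 1) ≤ f dx bx + f dy by' := by
  obtain ⟨h1, h2, h3⟩ := hf
  have md : ∀ k d b, f (d+1) b - f d (b+1) ≤ f (d+k+1) b - f (d+k) (b+1) := by
    intro k
    induction k with
    | zero => intro d b; simp
    | succ k ih =>
      intro d b
      have e1 := ih d b
      have e2 := h3 (d+k) b
      rw [show d+(k+1)=d+k+1 by ring]
      linarith
  have mb : ∀ k d b, f (d+1) (b+k) - f d (b+k+1) ≤ f (d+1) b - f d (b+1) := by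
    intro k
    induction k with
    | zero => intro d b; simp
    | succ k ih =>
      intro d b
      have e1 := ih d b
      have e2 := h2 d (b+k)
      rw [show b+(k+1)=b+k+1 by ring]
      linarith
  obtain ⟨e, rfl⟩ : ∃ e, dx = dy + e + 1 := ⟨dx - dy - 1, by omega⟩
  obtain ⟨k, rfl⟩ : ∃ k, by' = bx + k + 1 := ⟨by' - bx - 1, by omega⟩
  rw [Nat.add_sub_cancel, Nat.add_sub_cancel]
  linarith [md e dy bx, mb k dy bx]

theorem exists_gt_of_sum {n : ℕ} {p q : Fin n → ℕ} (h : ∑ i, p i = ∑ i, q i) {u : Fin n}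
    (hu : q u < p u) : ∃ v, p v < q v := by
  by_contra hc
  push Not at hc
  have := Finset.sum_lt_sum (s := Finset.univ) (fun i _ => hc i) ⟨u, Finset.mem_univ u, hu⟩
  omega

theorem SameTot.stn {n : ℕ} {x y : Alloc n} (h : SameTot x y) :
    ∑ i, stn x i = ∑ i, stn y i := by
  simp only [_root_.stn, Finset.sum_add_distrib, h.1, h.2]

theorem obj_add_le {n : ℕ} {c : Fin n → ℕ → ℕ → ℝ} {x y x' y' : Alloc n}
    (h : ∀ k, c k (x'.1 k) (x'.2 k) + c k (y'.1 k) (y'.2 k) ≤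
      c k (x.1 k) (x.2 k) + c k (y.1 k) (y.2 k)) :
    obj c x' + obj c y' ≤ obj c x + obj c y := by
  simp only [obj, ← Finset.sum_add_distrib]
  exact Finset.sum_le_sum fun k _ => h k

theorem exchange {n : ℕ} {c : Fin n → ℕ → ℕ → ℝ}
    (hc : ∀ i, Multimodular (c i)) {x y : Alloc n} (ht : SameTot x y) {u : Fin n}
    (hu : stn y u < stn x u) :
    ∃ v, stn x v < stn y v ∧ ∃ x' ∈ MoveFromTo x u v, ∃ y' ∈ MoveFromTo y v u,
      obj c x' + obj c y' ≤ obj c x + obj c y := by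
  have hS := ht.stn
  unfold stn at *
  by_cases hd : y.1 u < x.1 u
  · by_cases hA : ∃ v, x.1 v + x.2 v < y.1 v + y.2 v ∧ x.1 v < y.1 v
    · obtain ⟨v, hv, hvd⟩ := hA
      refine ⟨v, hv, _, Or.inl ⟨by omega, rfl⟩, _, Or.inl ⟨by omega, rfl⟩, obj_add_le fun k => ?_⟩
      have huv : u ≠ v := by rintro rfl; omega
      by_cases hku : k = u
      · subst hku
        simpa [moveOne, huv] using mm_d (hc k) hd hu
      by_cases hkv : k = v
      · subst hkv
        have := mm_d (hc k) hvd hv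
        simp [moveOne, hku]
        linarith
      simp [moveOne, hku, hkv]
    · push Not at hA
      obtain ⟨w, hw⟩ := exists_gt_of_sum ht.1 hd
      obtain ⟨v, hv⟩ := exists_gt_of_sum hS hu
      have hwS : y.1 w + y.2 w ≤ x.1 w + x.2 w := by
        by_contra hh
        have := hA w (by omega)
        omega
      have hvd := hA v hv
      refine ⟨v, hv, _, Or.inr (Or.inr (Or.inl ⟨w, by omega, by omega, rfl⟩)), _,
        Or.inr (Or.inr (Or.inr ⟨w, by omega, by omega, rfl⟩)), obj_add_le fun k => ?_⟩
      have huv : u ≠ v := by rintro rfl; omega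
      have huw : u ≠ w := by rintro rfl; omega
      have hvw : v ≠ w := by rintro rfl; omega
      by_cases hku : k = u
      · subst hku
        simpa [moveOne, huv, huw] using mm_d (hc k) hd hu
      by_cases hkv : k = v
      · subst hkv
        have := mm_b (hc k) (show x.2 k < y.2 k by omega) hv
        simp [moveOne, hku, hvw]
        linarith
      by_cases hkw : k = w
      · subst hkw
        have := mm_swap (hc k) (show x.1 k < y.1 k by omega) (show y.2 k < x.2 k by omega)
        simp [moveOne, hku, hkv]
        linarith
      simp [moveOne, hku, hkv, hkw]
  · have hb : y.2 u < x.2 u := by omega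
    by_cases hA : ∃ v, x.1 v + x.2 v < y.1 v + y.2 v ∧ x.2 v < y.2 v
    · obtain ⟨v, hv, hvd⟩ := hA
      refine ⟨v, hv, _, Or.inr (Or.inl ⟨by omega, rfl⟩), _, Or.inr (Or.inl ⟨by omega, rfl⟩),
        obj_add_le fun k => ?_⟩
      have huv : u ≠ v := by rintro rfl; omega
      by_cases hku : k = u
      · subst hku
        simpa [moveOne, huv] using mm_b (hc k) hb hu
      by_cases hkv : k = v
      · subst hkv
        have := mm_b (hc k) hvd hv
        simp [moveOne, hku]
        linarith
      simp [moveOne, hku, hkv]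
    · push Not at hA
      obtain ⟨w, hw⟩ := exists_gt_of_sum ht.2 hb
      obtain ⟨v, hv⟩ := exists_gt_of_sum hS hu
      have hwS : y.1 w + y.2 w ≤ x.1 w + x.2 w := by
        by_contra hh
        have := hA w (by omega)
        omega
      have hvd := hA v hv
      refine ⟨v, hv, _, Or.inr (Or.inr (Or.inr ⟨w, by omega, by omega, rfl⟩)), _,
        Or.inr (Or.inr (Or.inl ⟨w, by omega, by omega, rfl⟩)), obj_add_le fun k => ?_⟩
      have huv : u ≠ v := by rintro rfl; omega
      have huw : u ≠ w := by rintro rfl; omega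
      have hvw : v ≠ w := by rintro rfl; omega
      by_cases hku : k = u
      · subst hku
        simpa [moveOne, huv, huw] using mm_b (hc k) hb hu
      by_cases hkv : k = v
      · subst hkv
        have := mm_d (hc k) (show x.1 k < y.1 k by omega) hv
        simp [moveOne, hku, hvw]
        linarith
      by_cases hkw : k = w
      · subst hkw
        have := mm_swap (hc k) (show y.1 k < x.1 k by omega) (show x.2 k < y.2 k by omega)
        simp [moveOne, hku, hkv]
        linarith
      simp [moveOne, hku, hkv, hkw]

theorem moveOne_eq {n : ℕ} {v : Fin n → ℕ} {i j : Fin n} (h : 1 ≤ v i) (k : Fin n) :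
    moveOne v i j k + (if k = i then 1 else 0) = v k + (if k = j then 1 else 0) := by
  unfold moveOne
  by_cases hk : k = i
  · subst hk
    simp only [if_true]
    omega
  · simp [hk]

theorem moveOne_sum {n : ℕ} {v : Fin n → ℕ} {i j : Fin n} (h : 1 ≤ v i) :
    ∑ k, moveOne v i j k = ∑ k, v k := by
  have := Finset.sum_congr (s₁ := Finset.univ) rfl
    (fun k _ => moveOne_eq (v := v) (i := i) (j := j) h k)
  simp only [Finset.sum_add_distrib] at this
  simpa using this

theorem move_stn {n : ℕ} {a a' : Alloc n} {i j : Fin n} (h : a' ∈ MoveFromTo a i j) (k : Fin n) :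
    stn a' k + (if k = i then 1 else 0) = stn a k + (if k = j then 1 else 0) := by
  unfold stn
  rcases h with ⟨h, rfl⟩ | ⟨h, rfl⟩ | ⟨w, h, h', rfl⟩ | ⟨w, h, h', rfl⟩
  · have := moveOne_eq (j := j) h k
    simp only
    omega
  · have := moveOne_eq (j := j) h k
    simp only
    omega
  · have := moveOne_eq (j := w) h k
    have := moveOne_eq (j := j) h' k
    simp only
    omega
  · have := moveOne_eq (j := j) h k
    have := moveOne_eq (j := w) h' k
    simp only
    omega

theorem move_tot {n : ℕ} {a a' : Alloc n} {i j : Fin n} (h : a' ∈ MoveFromTo a i j) :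
    SameTot a' a := by
  rcases h with ⟨h, rfl⟩ | ⟨h, rfl⟩ | ⟨w, h, h', rfl⟩ | ⟨w, h, h', rfl⟩
  · exact ⟨moveOne_sum h, rfl⟩
  · exact ⟨rfl, moveOne_sum h⟩
  · exact ⟨moveOne_sum h, moveOne_sum h'⟩
  · exact ⟨moveOne_sum h, moveOne_sum h'⟩

theorem SameTot.symm {n : ℕ} {x y : Alloc n} (h : SameTot x y) : SameTot y x :=
  ⟨h.1.symm, h.2.symm⟩

theorem SameTot.trans {n : ℕ} {x y w : Alloc n} (h : SameTot x y) (h' : SameTot y w) :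
    SameTot x w :=
  ⟨h.1.trans h'.1, h.2.trans h'.2⟩

theorem mem_nbhd {n : ℕ} {a a' : Alloc n} {i j : Fin n} (h : a' ∈ MoveFromTo a i j) :
    a' ∈ Neighborhood a := by
  simp only [Neighborhood, Set.mem_iUnion]
  exact ⟨i, j, h⟩

/-- Effect of a single dock-move on the one-sided distance. -/
theorem updist_move {n : ℕ} {a x x' : Alloc n} {i j : Fin n} (h : x' ∈ MoveFromTo x i j) :
    updist a x' + (if stn a i < stn x i ∧ i ≠ j then 1 else 0) ≤
      updist a x + (if stn a j ≤ stn x j ∧ i ≠ j then 1 else 0) := by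
  have key : ∀ k, (stn x' k - stn a k) +
      (if k = i then (if stn a i < stn x i ∧ i ≠ j then 1 else 0) else 0) ≤
      (stn x k - stn a k) + (if k = j then (if stn a j ≤ stn x j ∧ i ≠ j then 1 else 0) else 0) := by
    intro k
    have := move_stn h k
    by_cases hi : k = i
    · subst hi
      by_cases hj : k = j
      · subst hj
        simp at this ⊢
        omega
      · simp [hj] at this ⊢
        split_ifs <;> omega
    · by_cases hj : k = j
      · subst hj
        have hik : i ≠ k := fun e => hi e.symm
        simp [hi, hik] at this ⊢
        split_ifs <;> omega
      · simp [hi, hj] at this ⊢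
        omega
  have := Finset.sum_le_sum (s := Finset.univ) (fun k _ => key k)
  simp only [Finset.sum_add_distrib, Finset.sum_ite_eq', Finset.mem_univ, if_true] at this
  exact this

theorem ball_facts {n : ℕ} {a : Alloc n} (z : ℕ) : ∀ x ∈ ball a z,
    SameTot x a ∧ updist a x ≤ z := by
  induction z with
  | zero =>
    intro x hx
    simp only [ball, Set.mem_singleton_iff] at hx
    subst hx
    exact ⟨⟨rfl, rfl⟩, by simp [updist]⟩
  | succ z ih =>
    intro x hx
    simp only [ball, Neighborhood, Set.mem_union, Set.mem_iUnion] at hx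
    rcases hx with hx | ⟨y, hy, i, j, hx⟩
    · have := ih x hx
      exact ⟨this.1, by omega⟩
    · have h1 := ih y hy
      refine ⟨(move_tot hx).trans h1.1, ?_⟩
      have := updist_move (a := a) hx
      split_ifs at this <;> omega

theorem exists_opt {n : ℕ} (c : Fin n → ℕ → ℕ → ℝ) (w : Alloc n) :
    ∃ w', SameTot w' w ∧ (∀ i, stn w' i = stn w i) ∧
      ∀ y, SameTot y w → (∀ i, stn y i = stn w i) → obj c w' ≤ obj c y := by
  have hfin : {y : Alloc n | SameTot y w ∧ ∀ i, stn y i = stn w i}.Finite := by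
    refine ((Set.finite_Icc (0 : Fin n → ℕ) (stn w)).prod
      (Set.finite_Icc (0 : Fin n → ℕ) (stn w))).subset ?_
    rintro y ⟨-, hy⟩
    refine ⟨⟨fun i => Nat.zero_le _, fun i => ?_⟩, ⟨fun i => Nat.zero_le _, fun i => ?_⟩⟩
    · have := hy i
      simp only [stn] at this ⊢
      omega
    · have := hy i
      simp only [stn] at this ⊢
      omega
  obtain ⟨w', hw', hmin⟩ := Set.exists_min_image _ (obj c) hfin ⟨w, ⟨rfl, rfl⟩, fun i => rfl⟩
  exact ⟨w', hw'.1, hw'.2, fun y h1 h2 => hmin y ⟨h1, h2⟩⟩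

theorem reach {n : ℕ} {c : Fin n → ℕ → ℕ → ℝ}
    (hc : ∀ i, Multimodular (c i)) {a : Alloc n} (hopt : BikeOptimal c a) (z : ℕ) :
    ∀ w, SameTot w a → updist a w ≤ z →
      ∃ w' ∈ ball a z, (∀ i, stn w' i = stn w i) ∧ obj c w' ≤ obj c w := by
  induction z with
  | zero =>
    intro w hw hz
    have hle : ∀ i, stn w i ≤ stn a i := by
      intro i
      have : updist a w = 0 := by omega
      rw [updist, Finset.sum_eq_zero_iff] at this
      have := this i (Finset.mem_univ i)
      omega
    have heq : ∀ i, stn w i = stn a i := by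
      intro i
      by_contra hne
      obtain ⟨v, hv⟩ := exists_gt_of_sum hw.stn.symm (u := i) (by have := hle i; omega)
      have := hle v
      omega
    exact ⟨a, rfl, fun i => (heq i).symm, hopt w heq hw.2⟩
  | succ z ih =>
    intro w hw hz
    by_cases hz' : updist a w ≤ z
    · obtain ⟨w', h1, h2⟩ := ih w hw hz'
      exact ⟨w', Or.inl h1, h2⟩
    have hex : ∃ u, stn a u < stn w u := by
      by_contra hh
      push Not at hh
      apply hz'
      have : updist a w = 0 := Finset.sum_eq_zero fun i _ => by have := hh i; omega
      omega
    obtain ⟨u, hu⟩ := hex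
    obtain ⟨v, hv, x', hx', -⟩ := exchange hc hw hu
    have huv : u ≠ v := by rintro rfl; omega
    obtain ⟨y0, hy0t, hy0s, hy0m⟩ := exists_opt c x'
    have hxd := updist_move (a := a) hx'
    have hyd : updist a y0 = updist a x' := by simp only [updist, hy0s]
    have hx'w := move_tot hx'
    obtain ⟨w1, hw1, hw1s, hw1c⟩ := ih y0 (hy0t.trans (hx'w.trans hw)) (by
      rw [hyd]
      simp only [hu, huv, ne_eq, not_false_eq_true, and_self, if_true] at hxd
      rw [if_neg (by omega)] at hxd
      omega)
    have hw1t := (ball_facts z w1 hw1).1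
    have hprof : ∀ k, stn w1 k + (if k = u then 1 else 0) = stn w k + (if k = v then 1 else 0) := by
      intro k
      rw [hw1s, hy0s]
      exact move_stn hx' k
    have hv1 : stn w v < stn w1 v := by
      have := hprof v
      rw [if_neg huv.symm, if_pos rfl] at this
      omega
    obtain ⟨u', hu', p, hp, q, hq, hpq⟩ := exchange hc (hw1t.trans hw.symm) hv1
    have : u' = u := by
      by_contra hne
      have := hprof u'
      rw [if_neg hne] at this
      omega
    subst this
    have hqs : ∀ k, stn q k = stn x' k := by
      intro k
      have h1 := move_stn hq k
      have h2 := hprof k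
      have h3 := hw1s k
      have h4 := hy0s k
      omega
    have hqc := hy0m q ((move_tot hq).trans hx'w.symm) hqs
    refine ⟨p, Or.inr ?_, ?_, by linarith⟩
    · simp only [Set.mem_iUnion]
      exact ⟨w1, hw1, mem_nbhd hp⟩
    · intro k
      have h1 := move_stn hp k
      have h2 := hprof k
      omega

theorem self_mem {n : ℕ} {a a' : Alloc n} (h : a' ∈ Neighborhood a) : a ∈ Neighborhood a := by
  simp only [Neighborhood, Set.mem_iUnion] at h
  obtain ⟨i, j, h⟩ := h
  have mv : ∀ (v : Fin n → ℕ), 1 ≤ v i → moveOne v i i = v := by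
    intro v hv
    funext k
    have := moveOne_eq (j := i) hv k
    omega
  have h1 : 1 ≤ a.1 i ∨ 1 ≤ a.2 i := by
    rcases h with ⟨h, -⟩ | ⟨h, -⟩ | ⟨w, h, h', -⟩ | ⟨w, h, h', -⟩
    · exact Or.inl h
    · exact Or.inr h
    · exact Or.inl h
    · exact Or.inr h'
  rcases h1 with h1 | h1
  · exact mem_nbhd (i := i) (j := i) (Or.inl ⟨h1, by rw [mv _ h1]⟩)
  · exact mem_nbhd (i := i) (j := i) (Or.inr (Or.inl ⟨h1, by rw [mv _ h1]⟩))

theorem updist_comm {n : ℕ} {a x : Alloc n} (h : SameTot x a) : updist a x = updist x a := by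
  have h1 : ∑ i, ((stn x i - stn a i) + stn a i) = ∑ i, ((stn a i - stn x i) + stn x i) :=
    Finset.sum_congr rfl fun i _ => by omega
  have := h.stn
  simp only [Finset.sum_add_distrib] at h1
  unfold updist
  omega

theorem find_up {n : ℕ} {c : Fin n → ℕ → ℕ → ℝ}
    (hc : ∀ i, Multimodular (c i)) {a az : Alloc n} {z : ℕ} {r : ℝ}
    (hza : SameTot az a) (hzd : updist a az ≤ z)
    (hmin : ∀ w, SameTot w a → updist a w ≤ z → obj c az ≤ obj c w)
    (hr : r ≤ obj c az) (hnb : ∀ w ∈ Neighborhood az, r ≤ obj c w) (m : ℕ) :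
    ∀ w, SameTot w a → updist a w ≤ z + 1 → obj c w < r → updist az w = m →
      ∃ j, stn az j < stn w j ∧ stn a j ≤ stn az j := by
  induction m with
  | zero =>
    intro w hw hwd hwr hm
    exfalso
    have hle : ∀ i, stn w i ≤ stn az i := by
      intro i
      rw [updist, Finset.sum_eq_zero_iff] at hm
      have := hm i (Finset.mem_univ i)
      omega
    have : updist a w ≤ updist a az := Finset.sum_le_sum fun i _ => by have := hle i; omega
    have := hmin w hw (by omega)
    linarith
  | succ m ih =>
    intro w hw hwd hwr hm
    by_contra hno
    push Not at hno
    have hex : ∃ u, stn az u - stn a u < stn w u - stn a u := by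
      by_contra hh
      push Not at hh
      have : updist a w ≤ updist a az := Finset.sum_le_sum fun i _ => hh i
      have := hmin w hw (by omega)
      linarith
    obtain ⟨u, hu⟩ := hex
    have hu1 : stn az u < stn w u := by omega
    have hu2 := hno u hu1
    obtain ⟨v, hv, x', hx', y', hy', hxy⟩ := exchange hc (hw.trans hza.symm) hu1
    have huv : u ≠ v := by rintro rfl; omega
    have hyr := hnb y' (mem_nbhd hy')
    have hxt := (move_tot hx').trans hw
    have hyt := (move_tot hy').trans hza
    have hxd := updist_move (a := a) hx'
    have hyd := updist_move (a := a) hy'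
    have hmd := updist_move (a := az) hx'
    rw [if_pos ⟨by omega, huv⟩] at hxd
    rw [if_pos ⟨by omega, huv⟩, if_neg (by omega)] at hmd
    rw [if_neg (c := stn a u ≤ stn az u ∧ v ≠ u) (by omega)] at hyd
    by_cases hva : stn a v ≤ stn w v
    · rw [if_pos ⟨hva, huv⟩] at hxd
      have := hmin y' hyt (by omega)
      have hmeq : updist az x' = m := by
        have hle : updist az w ≤ updist az x' + 1 := by
          have key : ∀ k, stn w k - stn az k ≤ (stn x' k - stn az k) + (if k = u then 1 else 0) := by
            intro k
            have := move_stn hx' k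
            omega
          have := Finset.sum_le_sum (s := Finset.univ) (fun k _ => key k)
          simpa [Finset.sum_add_distrib, updist] using this
        omega
      obtain ⟨j, hj1, hj2⟩ := ih x' hxt (by omega) (by linarith) hmeq
      have hjn := hno j
      have hjm := move_stn hx' j
      by_cases hjv : j = v
      · subst hjv
        rw [if_neg huv.symm, if_pos rfl] at hjm
        omega
      · rw [if_neg hjv] at hjm
        omega
    · rw [if_neg (by omega)] at hxd
      have := hmin x' hxt (by omega)
      linarith

theorem find_down {n : ℕ} {c : Fin n → ℕ → ℕ → ℝ}
    (hc : ∀ i, Multimodular (c i)) {a az : Alloc n} {z : ℕ} {r : ℝ}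
    (hza : SameTot az a) (hzd : updist a az ≤ z)
    (hmin : ∀ w, SameTot w a → updist a w ≤ z → obj c az ≤ obj c w)
    (hr : r ≤ obj c az) (hnb : ∀ w ∈ Neighborhood az, r ≤ obj c w) (m : ℕ) :
    ∀ w, SameTot w a → updist a w ≤ z + 1 → obj c w < r → updist az w = m →
      ∃ j, stn w j < stn az j ∧ stn az j ≤ stn a j := by
  induction m with
  | zero =>
    intro w hw hwd hwr hm
    exfalso
    have hle : ∀ i, stn w i ≤ stn az i := by
      intro i
      rw [updist, Finset.sum_eq_zero_iff] at hm
      have := hm i (Finset.mem_univ i)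
      omega
    have : updist a w ≤ updist a az := Finset.sum_le_sum fun i _ => by have := hle i; omega
    have := hmin w hw (by omega)
    linarith
  | succ m ih =>
    intro w hw hwd hwr hm
    by_contra hno
    push Not at hno
    have hex : ∃ u, stn a u - stn az u < stn a u - stn w u := by
      by_contra hh
      push Not at hh
      have : updist w a ≤ updist az a := Finset.sum_le_sum fun i _ => hh i
      rw [← updist_comm hw, ← updist_comm hza] at this
      have := hmin w hw (by omega)
      linarith
    obtain ⟨u, hu⟩ := hex
    have hu1 : stn w u < stn az u := by omega
    have hu2 := hno u hu1
    obtain ⟨v, hv, y', hy', x', hx', hxy⟩ := exchange hc (hza.trans hw.symm) hu1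
    have huv : v ≠ u := by rintro rfl; omega
    have hyr := hnb y' (mem_nbhd hy')
    have hxt := (move_tot hx').trans hw
    have hyt := (move_tot hy').trans hza
    have hxd := updist_move (a := a) hx'
    have hyd := updist_move (a := a) hy'
    have hmd := updist_move (a := az) hx'
    rw [if_neg (c := stn a u ≤ stn w u ∧ v ≠ u) (by omega)] at hxd
    rw [if_pos ⟨by omega, huv⟩, if_neg (by omega)] at hmd
    rw [if_pos (c := stn a u < stn az u ∧ u ≠ v) ⟨by omega, huv.symm⟩] at hyd
    by_cases hva : stn w v ≤ stn a v
    · have hyz : updist a y' ≤ z := by split_ifs at hyd <;> omega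
      have := hmin y' hyt hyz
      have hmeq : updist az x' = m := by
        have hle : updist az w ≤ updist az x' + 1 := by
          have key : ∀ k, stn w k - stn az k ≤ (stn x' k - stn az k) + (if k = v then 1 else 0) := by
            intro k
            have := move_stn hx' k
            omega
          have := Finset.sum_le_sum (s := Finset.univ) (fun k _ => key k)
          simpa [Finset.sum_add_distrib, updist] using this
        omega
      obtain ⟨j, hj1, hj2⟩ := ih x' hxt (by omega) (by linarith) hmeq
      have hjn := hno j
      have hjm := move_stn hx' j
      by_cases hjv : j = v
      · subst hjv
        rw [if_neg huv, if_pos rfl] at hjm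
        omega
      · rw [if_neg hjv] at hjm
        omega
    · rw [if_pos ⟨by omega, huv⟩] at hxd
      have := hmin x' hxt (by omega)
      linarith

/-- If `a^z` minimizes the objective over `S_z(a)`, `a^{z+1}` is a minimizer of the
objective over `N(a^z)`, and some `a⋆ ∈ S_{z+1}(a)` has strictly smaller objective than
`a^{z+1}`, then there exist stations `j` and `k` with
`d_j⋆+b_j⋆ > d_j^z+b_j^z ≥ d_j+b_j` and `d_k⋆+b_k⋆ < d_k^z+b_k^z ≤ d_k+b_k`. -/
theorem better_solution_structure {n : ℕ} (c : Fin n → ℕ → ℕ → ℝ)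
    (hc : ∀ i, Multimodular (c i)) (a az az1 astar : Alloc n) (z : ℕ)
    (hopt : BikeOptimal c a)
    (hzmem : az ∈ ball a z) (hzmin : ∀ x ∈ ball a z, obj c az ≤ obj c x)
    (h1mem : az1 ∈ Neighborhood az)
    (h1min : ∀ x ∈ Neighborhood az, obj c az1 ≤ obj c x)
    (hstar : astar ∈ ball a (z + 1))
    (hbetter : obj c astar < obj c az1) :
    ∃ j k : Fin n,
      (astar.1 j + astar.2 j > az.1 j + az.2 j ∧ az.1 j + az.2 j ≥ a.1 j + a.2 j) ∧
      (astar.1 k + astar.2 k < az.1 k + az.2 k ∧ az.1 k + az.2 k ≤ a.1 k + a.2 k) := by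
  have hz := ball_facts z az hzmem
  have hs := ball_facts (z + 1) astar hstar
  have hmin : ∀ w, SameTot w a → updist a w ≤ z → obj c az ≤ obj c w := by
    intro w hw hwd
    obtain ⟨w', h1, -, h2⟩ := reach hc hopt z w hw hwd
    exact (hzmin w' h1).trans h2
  have hr := h1min az (self_mem h1mem)
  obtain ⟨j, hj1, hj2⟩ := find_up hc hz.1 hz.2 hmin hr h1min _ astar hs.1 hs.2 hbetter rfl
  obtain ⟨k, hk1, hk2⟩ := find_down hc hz.1 hz.2 hmin hr h1min _ astar hs.1 hs.2 hbetter rfl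
  exact ⟨j, k, ⟨hj1, hj2⟩, ⟨hk1, hk2⟩⟩
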